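/- arXiv:1809.01729 — 4 statements merged into one kernel-verified Lean document; each statement's English description precedes it below -/
import Mathlib

section
/- Let k be a nonzero real number and η, t ∈ ℝ. Then (k² + (η − k t)²)⁻¹ ≤ 2 (k² + η²) / (k⁴ (1 + t²)). -/
/-- Pointwise decay of the multiplier of `Δₜ⁻¹`: for `k ≠ 0` and all `η, t`,
`(k² + (η - k t)²)⁻¹ ≤ 2 (k² + η²) / (k⁴ (1 + t²))`. -/
theorem stmt_9 (k η t : ℝ) (hk : k ≠ 0) :
    (k ^ 2 + (η - k * t) ^ 2)⁻¹ ≤ 2 * (k ^ 2 + η ^ 2) / (k ^ 4 * (1 + t ^ 2)) := by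
  rw [inv_eq_one_div, div_le_div_iff₀ (by positivity) (by positivity)]
  have h : 0 ≤ k ^ 4 + 2 * (η * (η - k * t)) ^ 2 + (k * (η + (η - k * t))) ^ 2 := by positivity
  linarith
end

section
/- Let k be a nonzero real number, η ∈ ℝ, and t ≥ 0. Then ∫₀ᵗ (k² + (η − k τ)²) dτ ≥ k² t + k² t³ / 12. Consequently, for every ν > 0, exp(−ν ∫₀ᵗ (k² + (η − k τ)²) dτ) ≤ exp(−ν k² t − ν k² t³ / 12). -/
open Real MeasureTheory intervalIntegral

/-- The dissipation exponent with the square in `η` completed. -/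
theorem integral_sq_add_sq_sub_mul (k η t : ℝ) :
    ∫ τ in (0:ℝ)..t, (k ^ 2 + (η - k * τ) ^ 2) =
      k ^ 2 * t + k ^ 2 * t ^ 3 / 12 + t * (η - k * t / 2) ^ 2 := by
  have hderiv (x : ℝ) : HasDerivAt
      (fun τ => k ^ 2 * τ + k ^ 2 * τ ^ 3 / 12 + τ * (η - k * τ / 2) ^ 2)
      (k ^ 2 + (η - k * x) ^ 2) x := by
    have hid := hasDerivAt_id' x
    refine HasDerivAt.congr_deriv (((hid.const_mul (k ^ 2)).add (((hid.pow 3).const_mul (k ^ 2)).div_const 12)).add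
      (hid.mul ((((hid.const_mul k).div_const 2).const_sub η).pow 2))) ?_
    norm_num
    ring
  rw [integral_eq_sub_of_hasDerivAt (fun x _ => hderiv x)
    (Continuous.intervalIntegrable (by fun_prop) 0 t)]
  ring

/-- Enhanced dissipation lower bound on the dissipation exponent: for `k ≠ 0`,
`η ∈ ℝ` and `t ≥ 0`, `∫₀ᵗ (k² + (η - kτ)²) dτ ≥ k² t + k² t³/12` (uniformly in `η`),
hence `exp(-ν ∫₀ᵗ k² + (η - kτ)² dτ) ≤ exp(-ν k² t - ν k² t³/12)` for every `ν > 0`. -/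
theorem stmt_11 (k η : ℝ) (hk : k ≠ 0) (t : ℝ) (ht : 0 ≤ t) :
    (k ^ 2 * t + k ^ 2 * t ^ 3 / 12 ≤
      ∫ τ in (0:ℝ)..t, (k ^ 2 + (η - k * τ) ^ 2)) ∧
    ∀ ν : ℝ, 0 < ν →
      Real.exp (-ν * ∫ τ in (0:ℝ)..t, (k ^ 2 + (η - k * τ) ^ 2)) ≤
        Real.exp (-ν * k ^ 2 * t - ν * k ^ 2 * t ^ 3 / 12) := by
  have hle : k ^ 2 * t + k ^ 2 * t ^ 3 / 12 ≤
      ∫ τ in (0:ℝ)..t, (k ^ 2 + (η - k * τ) ^ 2) := by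
    rw [integral_sq_add_sq_sub_mul]
    exact le_add_of_nonneg_right (by positivity)
  refine ⟨hle, fun ν hν => Real.exp_le_exp.mpr ?_⟩
  linarith [mul_le_mul_of_nonneg_left hle hν.le]
end

section
/- Let ν > 0, let k be a nonzero real number, and let η, W₀ ∈ ℝ (or ℂ). If W solves W′(t) + ν (k² + (η − k t)²) W(t) = 0 with W(0) = W₀, then |W(t)| ≤ exp(−ν k² t − ν k² t³ / 12) |W₀| for all t ≥ 0. -/
open Real

/-- The norm of a solution of the scalar linear equation `W' = -a W`, in terms of a primitive
`A` of the real coefficient `a`. -/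
theorem norm_eq_exp_mul_of_hasDerivAt_neg_mul {a A : ℝ → ℝ} {W : ℝ → ℂ}
    (hA : ∀ t, HasDerivAt A (a t) t) (hW : ∀ t, HasDerivAt W (-(a t : ℂ) * W t) t) (t : ℝ) :
    ‖W t‖ = Real.exp (A 0 - A t) * ‖W 0‖ := by
  have hderiv : ∀ s, HasDerivAt (fun s => Complex.exp (A s) * W s) 0 s := fun s => by
    refine ((hA s).ofReal_comp.cexp.mul (hW s)).congr_deriv ?_
    ring
  have hconst := is_const_of_deriv_eq_zero (fun s => (hderiv s).differentiableAt)
    (fun s => (hderiv s).deriv) t 0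
  have hnorm := congrArg norm hconst
  simp only [norm_mul, Complex.norm_exp, Complex.ofReal_re] at hnorm
  rw [Real.exp_sub, div_mul_eq_mul_div, ← hnorm, mul_div_cancel_left₀ _ (Real.exp_ne_zero _)]

/-- Enhanced dissipation for a single Fourier mode `(k,η)`, `k ≠ 0`, of the unforced
linearized Navier–Stokes equation around Couette flow in sheared coordinates: if
`W' + ν (k² + (η - k t)²) W = 0` with `W(0) = W₀`, then
`|W(t)| ≤ exp(-ν k² t - ν k² t³/12) |W₀|` for all `t ≥ 0`. -/
theorem stmt_12 (ν : ℝ) (hν : 0 < ν) (k : ℝ) (hk : k ≠ 0) (η : ℝ) (W₀ : ℂ)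
    (W : ℝ → ℂ)
    (hW : ∀ t : ℝ,
      HasDerivAt W (-((ν * (k ^ 2 + (η - k * t) ^ 2) : ℝ) : ℂ) * W t) t)
    (hW0 : W 0 = W₀) :
    ∀ t : ℝ, 0 ≤ t →
      ‖W t‖ ≤ Real.exp (-ν * k ^ 2 * t - ν * k ^ 2 * t ^ 3 / 12) * ‖W₀‖ := by
  intro t ht
  have hA : ∀ s, HasDerivAt
      (fun s : ℝ => ν * ((k ^ 2 + η ^ 2) * s - η * k * s ^ 2 + k ^ 2 / 3 * s ^ 3))
      (ν * (k ^ 2 + (η - k * s) ^ 2)) s := fun s => by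
    refine (((((hasDerivAt_id s).const_mul (k ^ 2 + η ^ 2)).sub
      ((hasDerivAt_pow 2 s).const_mul (η * k))).add
      ((hasDerivAt_pow 3 s).const_mul (k ^ 2 / 3))).const_mul ν).congr_deriv ?_
    push_cast
    ring
  rw [norm_eq_exp_mul_of_hasDerivAt_neg_mul hA hW t, hW0]
  refine mul_le_mul_of_nonneg_right (Real.exp_le_exp.2 ?_) (norm_nonneg _)
  have hsq : 0 ≤ ν * t * (η - k * t / 2) ^ 2 := by positivity
  linarith
end

section
/- Let 0 < ν, let k, η be real numbers with |k| ≥ 1 and |η| ≥ 1. Then b_∞(k,η) := ∫₀^∞ exp(−ν k² ξ − ν ∫₀^ξ (η + k σ)² dσ) dξ satisfies b_∞(k,η) ≥ (1 − e^{−3ν}) / (3ν (k² + η²)). In particular b_∞(k,η) only decays at an algebraic rate (k² + η²)⁻¹ in the frequencies, not exponentially. -/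
open Real MeasureTheory intervalIntegral

theorem integral_sq_add_mul (k η ξ : ℝ) :
    ∫ σ in (0:ℝ)..ξ, (η + k * σ) ^ 2 = η ^ 2 * ξ + η * k * ξ ^ 2 + k ^ 2 * ξ ^ 3 / 3 := by
  have hderiv : ∀ σ ∈ Set.uIcc (0:ℝ) ξ,
      HasDerivAt (fun σ : ℝ => η ^ 2 * σ + η * k * σ ^ 2 + k ^ 2 * σ ^ 3 / 3)
        ((η + k * σ) ^ 2) σ := by
    intro σ _
    refine ((((hasDerivAt_id' σ).const_mul (η ^ 2)).add
      ((hasDerivAt_pow 2 σ).const_mul (η * k))).add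
      (((hasDerivAt_pow 3 σ).const_mul (k ^ 2)).div_const 3)).congr_deriv ?_
    push_cast
    ring
  rw [integral_eq_sub_of_hasDerivAt hderiv ((by fun_prop : Continuous _).intervalIntegrable _ _)]
  ring

theorem integral_exp_neg_mul {a : ℝ} (ha : a ≠ 0) (T : ℝ) :
    ∫ ξ in (0:ℝ)..T, Real.exp (-a * ξ) = (1 - Real.exp (-a * T)) / a := by
  rw [integral_comp_mul_left (fun x => Real.exp x) (neg_ne_zero.mpr ha), integral_exp]
  simp only [mul_zero, Real.exp_zero, smul_eq_mul]
  field_simp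
  ring

theorem integrableOn_exp_neg_sub_integral_sq {ν k : ℝ} (η : ℝ) (hν : 0 < ν) (hk : k ≠ 0) :
    IntegrableOn (fun ξ : ℝ =>
      Real.exp (-ν * k ^ 2 * ξ - ν * ∫ σ in (0:ℝ)..ξ, (η + k * σ) ^ 2)) (Set.Ioi 0) := by
  have hdom : IntegrableOn (fun ξ : ℝ => Real.exp (-(ν * k ^ 2) * ξ)) (Set.Ioi 0) :=
    exp_neg_integrableOn_Ioi 0 (by positivity)
  refine hdom.mono' ?_ ((ae_restrict_mem measurableSet_Ioi).mono fun ξ hξ => ?_)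
  · simp only [integral_sq_add_mul]
    exact (by fun_prop : Continuous _).aestronglyMeasurable
  · have hnonneg : 0 ≤ ∫ σ in (0:ℝ)..ξ, (η + k * σ) ^ 2 :=
      integral_nonneg (le_of_lt hξ) fun σ _ => sq_nonneg _
    rw [Real.norm_of_nonneg (Real.exp_pos _).le, Real.exp_le_exp]
    nlinarith [mul_nonneg hν.le hnonneg]

/-- On the time scale `1 / (k² + η²)` the dissipation exponent is dominated by its linear part. -/
theorem mul_add_integral_sq_le {k η ξ : ℝ} (hS : 1 ≤ k ^ 2 + η ^ 2) (h0 : 0 ≤ ξ)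
    (h1 : ξ ≤ 1 / (k ^ 2 + η ^ 2)) :
    k ^ 2 * ξ + ∫ σ in (0:ℝ)..ξ, (η + k * σ) ^ 2 ≤ 3 * (k ^ 2 + η ^ 2) * ξ := by
  have hξ : ξ ≤ 1 := h1.trans ((div_le_one (by linarith)).mpr hS)
  have hsq : ξ ^ 2 ≤ ξ := by nlinarith
  have hcube : ξ ^ 3 ≤ ξ := by nlinarith
  have hcross : η * k * ξ ^ 2 ≤ (k ^ 2 + η ^ 2) * ξ := by
    have : η * k ≤ k ^ 2 + η ^ 2 := by nlinarith [sq_nonneg (k - η), sq_nonneg k, sq_nonneg η]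
    calc η * k * ξ ^ 2 ≤ (k ^ 2 + η ^ 2) * ξ ^ 2 := by gcongr
      _ ≤ (k ^ 2 + η ^ 2) * ξ := by gcongr
  have hcubic : k ^ 2 * ξ ^ 3 ≤ k ^ 2 * ξ := by gcongr
  rw [integral_sq_add_mul]
  nlinarith [mul_nonneg (sq_nonneg k) h0, mul_nonneg (sq_nonneg η) h0]

/-- Algebraic lower bound for the limiting multiplier
`b_∞(k,η) = ∫₀^∞ exp(-ν k² ξ - ν ∫₀^ξ (η + kσ)² dσ) dξ` of the resonantly forced
linearized Navier–Stokes equation around Couette flow: for `ν > 0`, `|k| ≥ 1`,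
`|η| ≥ 1`, one has `b_∞(k,η) ≥ (1 - e^{-3ν})/(3ν (k² + η²))`, i.e. only algebraic
decay in the frequencies. -/
theorem stmt_14 (ν k η : ℝ) (hν : 0 < ν) (hk : 1 ≤ |k|) (hη : 1 ≤ |η|) :
    (1 - Real.exp (-(3 * ν))) / (3 * ν * (k ^ 2 + η ^ 2)) ≤
      ∫ ξ in Set.Ioi (0:ℝ),
        Real.exp (-ν * k ^ 2 * ξ - ν * ∫ σ in (0:ℝ)..ξ, (η + k * σ) ^ 2) := by
  have hk2 : 1 ≤ k ^ 2 := (one_le_sq_iff_one_le_abs k).mpr hk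
  have hS : 1 ≤ k ^ 2 + η ^ 2 := by nlinarith [sq_nonneg η]
  have hSpos : 0 < k ^ 2 + η ^ 2 := by linarith
  have hT : 0 ≤ 1 / (k ^ 2 + η ^ 2) := by positivity
  have hint := integrableOn_exp_neg_sub_integral_sq η hν (k := k) (by rintro rfl; norm_num at hk)
  have hsub : Set.Ioc 0 (1 / (k ^ 2 + η ^ 2)) ⊆ Set.Ioi (0:ℝ) := Set.Ioc_subset_Ioi_self
  calc (1 - Real.exp (-(3 * ν))) / (3 * ν * (k ^ 2 + η ^ 2))
      = ∫ ξ in (0:ℝ)..1 / (k ^ 2 + η ^ 2), Real.exp (-(3 * ν * (k ^ 2 + η ^ 2)) * ξ) := by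
        rw [integral_exp_neg_mul (by positivity)]
        congr 3
        field_simp
    _ = ∫ ξ in Set.Ioc 0 (1 / (k ^ 2 + η ^ 2)), Real.exp (-(3 * ν * (k ^ 2 + η ^ 2)) * ξ) :=
        integral_of_le hT
    _ ≤ ∫ ξ in Set.Ioc 0 (1 / (k ^ 2 + η ^ 2)),
          Real.exp (-ν * k ^ 2 * ξ - ν * ∫ σ in (0:ℝ)..ξ, (η + k * σ) ^ 2) := by
        refine setIntegral_mono_on (Continuous.integrableOn_Ioc (by fun_prop))
          (hint.mono_set hsub) measurableSet_Ioc fun ξ hξ => ?_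
        rw [Real.exp_le_exp]
        nlinarith [mul_le_mul_of_nonneg_left (mul_add_integral_sq_le hS hξ.1.le hξ.2) hν.le]
    _ ≤ _ := setIntegral_mono_set hint (ae_of_all _ fun _ => (Real.exp_pos _).le)
        hsub.eventuallyLE
end
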